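/- Fix an integer s ≥ 1, real coefficients α_0, …, α_s with α_0 = α_1 = 1, an integer k ≥ 1, and reals μ, ν with μ = 0 in case k = 1. Then there exists a constant C > 0, depending only on s, α_0, …, α_s, k, μ, ν, such that for every real Hilbert space V, every semi-negative continuous linear operator Z on V with ‖Z‖ ≤ λ for some λ ∈ (0, 1], every ε ∈ (0, 1), and every u0 ∈ V, the filtering step satisfies ‖u_F‖² − ‖u_+‖² ≤ (−μ + ε|μ|) [Z^{k−1} u0]² + (2ν + Cλ/ε) ‖Z^k u0‖², where u_+ := R(Z)u0 and u_F := (I + μ(Z†)^{k−1}Z^k + ν(Z†)^kZ^k) u_+. -/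

import Mathlib

open RealInnerProductSpace ContinuousLinearMap

/-- The semi-inner-product `[v, w] := −⟨Zv, w⟩ − ⟨v, Zw⟩` associated with `Z`. -/
noncomputable def semiIP {V : Type*} [NormedAddCommGroup V] [InnerProductSpace ℝ V]
    (Z : V →L[ℝ] V) (v w : V) : ℝ :=
  -⟪Z v, w⟫ - ⟪v, Z w⟫

section

variable {V : Type*} [NormedAddCommGroup V] [InnerProductSpace ℝ V]

theorem semiIP_self (Z : V →L[ℝ] V) (v : V) : semiIP Z v v = -2 * ⟪v, Z v⟫ := by
  rw [semiIP, real_inner_comm]; ring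

theorem semiIP_comm (Z : V →L[ℝ] V) (v w : V) : semiIP Z v w = semiIP Z w v := by
  rw [semiIP, semiIP, real_inner_comm w, real_inner_comm (Z w)]; ring

theorem semiIP_self_nonneg {Z : V →L[ℝ] V} (hZ : ∀ v : V, ⟪Z v, v⟫ ≤ 0) (v : V) :
    0 ≤ semiIP Z v v := by
  have := hZ v
  rw [real_inner_comm] at this
  rw [semiIP_self]; linarith

theorem semiIP_self_smul_add (Z : V →L[ℝ] V) (c : ℝ) (v w : V) :
    semiIP Z (c • v + w) (c • v + w) =
      c ^ 2 * semiIP Z v v + 2 * c * semiIP Z v w + semiIP Z w w := by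
  have h := semiIP_comm Z v w
  simp only [semiIP, map_add, map_smul, inner_add_left, inner_add_right, real_inner_smul_left,
    real_inner_smul_right] at h ⊢
  linear_combination (-c) * h

theorem semiIP_self_le {Z : V →L[ℝ] V} {lam : ℝ} (hZ : ‖Z‖ ≤ lam) (v : V) :
    semiIP Z v v ≤ 2 * lam * ‖v‖ ^ 2 := by
  have h1 := (abs_le.mp (abs_real_inner_le_norm v (Z v))).1
  have h2 := mul_le_mul_of_nonneg_left (Z.le_of_opNorm_le hZ v) (norm_nonneg v)
  rw [semiIP_self]
  nlinarith

/-- Weighted Cauchy–Schwarz: perturbing `v` by `w` changes the squared seminorm of `v` by at most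
`ε [v]²` plus a multiple of `[w]²`. -/
theorem abs_semiIP_self_add_sub_le {Z : V →L[ℝ] V} (hZ : ∀ v : V, ⟪Z v, v⟫ ≤ 0)
    {ε : ℝ} (hε : 0 < ε) (v w : V) :
    |semiIP Z (v + w) (v + w) - semiIP Z v v| ≤
      ε * semiIP Z v v + (1 + 1 / ε) * semiIP Z w w := by
  have e := semiIP_self_smul_add Z 1 v w
  rw [one_smul] at e
  have hp := mul_nonneg (one_div_pos.mpr hε).le (semiIP_self_nonneg hZ (ε • v + w))
  have hm := mul_nonneg (one_div_pos.mpr hε).le (semiIP_self_nonneg hZ ((-ε) • v + w))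
  have hp' : 1 / ε * semiIP Z (ε • v + w) (ε • v + w) =
      ε * semiIP Z v v + 2 * semiIP Z v w + 1 / ε * semiIP Z w w := by
    rw [semiIP_self_smul_add]; field_simp
  have hm' : 1 / ε * semiIP Z ((-ε) • v + w) ((-ε) • v + w) =
      ε * semiIP Z v v - 2 * semiIP Z v w + 1 / ε * semiIP Z w w := by
    rw [semiIP_self_smul_add]; field_simp; ring
  have hw := semiIP_self_nonneg hZ w
  rw [abs_le]
  constructor <;> linarith

theorem abs_norm_add_sq_sub_le {y z : V} {c : ℝ} (hz : ‖z‖ ≤ c * ‖y‖) :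
    |‖y + z‖ ^ 2 - ‖y‖ ^ 2| ≤ (2 * c + c ^ 2) * ‖y‖ ^ 2 := by
  have h1 := abs_le.mp (abs_real_inner_le_norm y z)
  have h2 := mul_le_mul_of_nonneg_left hz (norm_nonneg y)
  have h3 := pow_le_pow_left₀ (norm_nonneg z) hz 2
  have h4 := sq_nonneg ‖z‖
  rw [norm_add_sq_real, abs_le]
  constructor <;> nlinarith

theorem norm_sum_smul_pow_le (n : ℕ) (a : ℕ → ℝ) {Z : V →L[ℝ] V} (hZ : ‖Z‖ ≤ 1) (v : V) :
    ‖(∑ j ∈ Finset.range n, a j • Z ^ j) v‖ ≤ (∑ j ∈ Finset.range n, |a j|) * ‖v‖ := by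
  have hpow (j : ℕ) : ‖(Z ^ j) v‖ ≤ ‖v‖ := by
    induction j with
    | zero => simp
    | succ j ih =>
      rw [pow_succ', mul_apply_eq_comp]
      exact (Z.le_of_opNorm_le hZ _).trans (by simpa using ih)
  rw [sum_apply, Finset.sum_mul]
  refine (norm_sum_le _ _).trans (Finset.sum_le_sum fun j _ => ?_)
  rw [smul_apply, norm_smul, Real.norm_eq_abs]
  exact mul_le_mul_of_nonneg_left (hpow j) (abs_nonneg _)

theorem sum_range_succ_smul_pow (n : ℕ) (a : ℕ → ℝ) (ha : a 0 = 1) (Z : V →L[ℝ] V) :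
    ∑ j ∈ Finset.range (n + 1), a j • Z ^ j =
      1 + Z * ∑ j ∈ Finset.range n, a (j + 1) • Z ^ j := by
  rw [Finset.sum_range_succ', Finset.mul_sum, add_comm]
  simp [ha, pow_succ']

theorem commute_sum_smul_pow (n : ℕ) (a : ℕ → ℝ) (Z : V →L[ℝ] V) :
    Commute Z (∑ j ∈ Finset.range n, a j • Z ^ j) :=
  Commute.sum_right _ _ _ fun j _ => ((Commute.refl Z).pow_right j).smul_right (a j)

variable [CompleteSpace V]

theorem inner_adjoint_pow_mul (Z : V →L[ℝ] V) (m : ℕ) (T : V →L[ℝ] V) (v : V) :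
    ⟪v, (adjoint Z ^ m * T) v⟫ = ⟪(Z ^ m) v, T v⟫ := by
  have h : adjoint Z ^ m = adjoint (Z ^ m) := by
    simp only [← star_eq_adjoint, star_pow]
  rw [h, mul_apply_eq_comp, adjoint_inner_right]

theorem norm_adjoint_pow_mul_le {Z : V →L[ℝ] V} {lam : ℝ} (hlam : lam ≤ 1)
    (hZ : ‖Z‖ ≤ lam) {m : ℕ} (hm : m ≠ 0) (T : V →L[ℝ] V) (v : V) :
    ‖(adjoint Z ^ m * T) v‖ ≤ lam * ‖T v‖ := by
  have h0 : 0 ≤ lam := (norm_nonneg Z).trans hZ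
  refine (adjoint Z ^ m).le_of_opNorm_le ?_ (T v)
  calc ‖adjoint Z ^ m‖ ≤ ‖adjoint Z‖ ^ m := norm_pow_le' _ (Nat.pos_of_ne_zero hm)
    _ = ‖Z‖ ^ m := by rw [LinearIsometryEquiv.norm_map]
    _ ≤ lam ^ m := pow_le_pow_left₀ (norm_nonneg _) hZ m
    _ ≤ lam := pow_le_of_le_one h0 hlam hm

/-- Energy change of the filter in terms of the filtered vector `w`. -/
theorem filter_energy_le {Z : V →L[ℝ] V} {lam : ℝ} (hlam : lam ≤ 1) (hZ : ‖Z‖ ≤ lam)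
    {k : ℕ} (hk : 1 ≤ k) {μ ν : ℝ} (hμ : k = 1 → μ = 0) (w : V) :
    ‖((1 : V →L[ℝ] V) + μ • (adjoint Z ^ (k - 1) * Z ^ k)
        + ν • (adjoint Z ^ k * Z ^ k)) w‖ ^ 2 - ‖w‖ ^ 2 ≤
      -μ * semiIP Z ((Z ^ (k - 1)) w) ((Z ^ (k - 1)) w) + 2 * ν * ‖(Z ^ k) w‖ ^ 2
        + (|μ| + |ν|) ^ 2 * lam * ‖(Z ^ k) w‖ ^ 2 := by
  have h0 : 0 ≤ lam := (norm_nonneg Z).trans hZ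
  have hA : ‖μ • (adjoint Z ^ (k - 1) * Z ^ k) w‖ ≤ |μ| * (lam * ‖(Z ^ k) w‖) := by
    rw [norm_smul, Real.norm_eq_abs]
    rcases hk.eq_or_lt with h | h
    · simp [hμ h.symm]
    · exact mul_le_mul_of_nonneg_left
        (norm_adjoint_pow_mul_le hlam hZ (by lia) _ _) (abs_nonneg _)
  have hB : ‖ν • (adjoint Z ^ k * Z ^ k) w‖ ≤ |ν| * (lam * ‖(Z ^ k) w‖) := by
    rw [norm_smul, Real.norm_eq_abs]
    exact mul_le_mul_of_nonneg_left
      (norm_adjoint_pow_mul_le hlam hZ (by lia) _ _) (abs_nonneg _)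
  have hsum := (norm_add_le _ _).trans (add_le_add hA hB)
  have hsq := pow_le_pow_left₀ (norm_nonneg _) hsum 2
  have hlam2 : (|μ| + |ν|) ^ 2 * ‖(Z ^ k) w‖ ^ 2 * lam ^ 2 ≤
      (|μ| + |ν|) ^ 2 * ‖(Z ^ k) w‖ ^ 2 * lam :=
    mul_le_mul_of_nonneg_left (pow_le_of_le_one h0 hlam two_ne_zero) (by positivity)
  have hk' : (Z ^ k) w = Z ((Z ^ (k - 1)) w) := by
    rw [← mul_apply_eq_comp, ← pow_succ', Nat.sub_add_cancel hk]
  have hF : ((1 : V →L[ℝ] V) + μ • (adjoint Z ^ (k - 1) * Z ^ k)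
      + ν • (adjoint Z ^ k * Z ^ k)) w =
      w + (μ • (adjoint Z ^ (k - 1) * Z ^ k) w + ν • (adjoint Z ^ k * Z ^ k) w) := by
    simp only [add_apply, smul_apply, one_apply_eq_self, add_assoc]
  rw [hF, norm_add_sq_real, inner_add_right, real_inner_smul_right, real_inner_smul_right,
    inner_adjoint_pow_mul, inner_adjoint_pow_mul, real_inner_self_eq_norm_sq, semiIP_self, ← hk']
  nlinarith

end

/-- upper bound on the energy change of the filtering step. -/
theorem filtering_energy_upper_bound
    (s : ℕ) (hs : 1 ≤ s) (α : ℕ → ℝ) (hα0 : α 0 = 1) (hα1 : α 1 = 1)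
    (k : ℕ) (hk : 1 ≤ k) (μ ν : ℝ) (hμ : k = 1 → μ = 0) :
    ∃ C : ℝ, 0 < C ∧
      ∀ (V : Type*) [NormedAddCommGroup V] [InnerProductSpace ℝ V] [CompleteSpace V]
        (Z : V →L[ℝ] V), (∀ v : V, ⟪Z v, v⟫ ≤ 0) →
        ∀ lam : ℝ, 0 < lam → lam ≤ 1 → ‖Z‖ ≤ lam →
        ∀ ε : ℝ, 0 < ε → ε < 1 → ∀ u0 : V,
          ‖((1 : V →L[ℝ] V) + μ • (adjoint Z ^ (k - 1) * Z ^ k)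
              + ν • (adjoint Z ^ k * Z ^ k))
            ((∑ j ∈ Finset.range (s + 1), α j • Z ^ j) u0)‖ ^ 2
            - ‖(∑ j ∈ Finset.range (s + 1), α j • Z ^ j) u0‖ ^ 2
          ≤ (-μ + ε * |μ|) * semiIP Z ((Z ^ (k - 1)) u0) ((Z ^ (k - 1)) u0)
            + (2 * ν + C * lam / ε) * ‖(Z ^ k) u0‖ ^ 2 := by
  set K : ℝ := ∑ j ∈ Finset.range s, |α (j + 1)|
  have hK0 : 0 ≤ K := Finset.sum_nonneg fun _ _ => abs_nonneg _
  set D : ℝ := 2 * |ν| * (2 * K + K ^ 2) + (|μ| + |ν|) ^ 2 * (1 + (2 * K + K ^ 2)) with hD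
  have hD0 : 0 ≤ D := by positivity
  refine ⟨4 * |μ| * K ^ 2 + D + 1, by positivity, ?_⟩
  intro V _ _ _ Z hneg lam hlam0 hlam hZ ε hε0 hε u0
  set R := ∑ j ∈ Finset.range (s + 1), α j • Z ^ j
  set Q := ∑ j ∈ Finset.range s, α (j + 1) • Z ^ j
  have hRQ : R = 1 + Z * Q := sum_range_succ_smul_pow s α hα0 Z
  have hZR : Commute Z R := commute_sum_smul_pow _ _ _
  have hZQ : Commute Z Q := commute_sum_smul_pow _ (fun j => α (j + 1)) _
  have hpow (m : ℕ) : (Z ^ m) (R u0) = R ((Z ^ m) u0) :=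
    DFunLike.congr_fun (hZR.pow_left m).eq u0
  set x := (Z ^ (k - 1)) u0 with hx
  set y := (Z ^ k) u0 with hy
  have hxy : Z x = y := by
    rw [hx, hy, ← mul_apply_eq_comp, ← pow_succ', Nat.sub_add_cancel hk]
  have hRx : R x = x + Q y := by
    rw [hRQ, hZQ.eq, add_apply, one_apply_eq_self, mul_apply_eq_comp, hxy]
  have hRy : R y = y + Z (Q y) := by
    rw [hRQ, add_apply, one_apply_eq_self, mul_apply_eq_comp]
  have hQy : ‖Q y‖ ≤ K * ‖y‖ :=
    norm_sum_smul_pow_le s (fun j => α (j + 1)) (hZ.trans hlam) y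
  have hZQy : ‖Z (Q y)‖ ≤ lam * K * ‖y‖ := by
    rw [mul_assoc]
    exact (Z.le_of_opNorm_le hZ _).trans (mul_le_mul_of_nonneg_left hQy hlam0.le)
  have henergy := filter_energy_le (ν := ν) hlam hZ hk hμ (R u0)
  rw [hpow, hpow, ← hx, ← hy, hRx, hRy] at henergy
  refine henergy.trans ?_
  have hy2 := sq_nonneg ‖y‖
  have hnorm : |‖y + Z (Q y)‖ ^ 2 - ‖y‖ ^ 2| ≤ lam * (2 * K + K ^ 2) * ‖y‖ ^ 2 := by
    refine (abs_norm_add_sq_sub_le hZQy).trans (mul_le_mul_of_nonneg_right ?_ hy2)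
    nlinarith [mul_le_mul_of_nonneg_right (pow_le_of_le_one hlam0.le hlam two_ne_zero)
      (sq_nonneg K)]
  have hnu : 2 * ν * ‖y + Z (Q y)‖ ^ 2 ≤
      2 * ν * ‖y‖ ^ 2 + 2 * |ν| * (lam * (2 * K + K ^ 2) * ‖y‖ ^ 2) := by
    have h1 := le_abs_self (ν * (‖y + Z (Q y)‖ ^ 2 - ‖y‖ ^ 2))
    rw [abs_mul] at h1
    have h2 := mul_le_mul_of_nonneg_left hnorm (abs_nonneg ν)
    linarith
  have hquad : (|μ| + |ν|) ^ 2 * lam * ‖y + Z (Q y)‖ ^ 2 ≤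
      (|μ| + |ν|) ^ 2 * lam * ((1 + (2 * K + K ^ 2)) * ‖y‖ ^ 2) := by
    refine mul_le_mul_of_nonneg_left ?_ (by positivity)
    have h1 := (abs_le.mp hnorm).2
    have h2 : lam * ((2 * K + K ^ 2) * ‖y‖ ^ 2) ≤ (2 * K + K ^ 2) * ‖y‖ ^ 2 :=
      mul_le_of_le_one_left (by positivity) hlam
    linarith
  have hε1 : 1 ≤ 1 / ε := (one_le_div hε0).mpr hε.le
  have hQsemi : (1 + 1 / ε) * semiIP Z (Q y) (Q y) ≤ 4 * K ^ 2 * lam / ε * ‖y‖ ^ 2 := by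
    calc (1 + 1 / ε) * semiIP Z (Q y) (Q y)
        ≤ (1 / ε + 1 / ε) * (2 * lam * (K * ‖y‖) ^ 2) := by
          refine mul_le_mul (by linarith) ?_ (semiIP_self_nonneg hneg _) (by positivity)
          exact (semiIP_self_le hZ _).trans (by gcongr)
      _ = _ := by ring
  have hmu : -μ * semiIP Z (x + Q y) (x + Q y) ≤ -μ * semiIP Z x x +
      |μ| * (ε * semiIP Z x x + 4 * K ^ 2 * lam / ε * ‖y‖ ^ 2) := by
    have h1 := neg_le_abs (μ * (semiIP Z (x + Q y) (x + Q y) - semiIP Z x x))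
    rw [abs_mul] at h1
    have h2 := mul_le_mul_of_nonneg_left
      ((abs_semiIP_self_add_sub_le hneg hε0 x (Q y)).trans (add_le_add_right hQsemi _))
      (abs_nonneg μ)
    linarith
  have hDε : D * lam * ‖y‖ ^ 2 ≤ D * lam * ‖y‖ ^ 2 * (1 / ε) :=
    le_mul_of_one_le_right (by positivity) hε1
  have hrest : 0 ≤ lam * ‖y‖ ^ 2 * (1 / ε) := by positivity
  calc _ ≤ (-μ + ε * |μ|) * semiIP Z x x + 2 * ν * ‖y‖ ^ 2
        + |μ| * (4 * K ^ 2 * lam / ε * ‖y‖ ^ 2) + D * lam * ‖y‖ ^ 2 := by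
        rw [hD]; linarith
    _ ≤ (-μ + ε * |μ|) * semiIP Z x x + 2 * ν * ‖y‖ ^ 2
        + |μ| * (4 * K ^ 2 * lam / ε * ‖y‖ ^ 2) + D * lam * ‖y‖ ^ 2 * (1 / ε)
        + lam * ‖y‖ ^ 2 * (1 / ε) := by linarith
    _ = _ := by ring
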